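/- arXiv:2410.04373 — 7 statements merged into one kernel-verified Lean document; each statement's English description precedes it below -/
import Mathlib

section
/- Let Z be a nonempty finite set, μ a probability mass function on Z, and 𝒳 a nonempty finite family of functions f : Z → ℝ satisfying 0 ≤ f(z) ≤ M for all f ∈ 𝒳 and all z ∈ Z. Let ε > 0 and δ ≥ 1 be real numbers with |𝒳| · δ ≥ 2, and let T be a positive integer with T ≥ (M²/ε²) · (log|𝒳| + log δ) (natural logarithms). Then with probability at least 1 − 1/δ over T i.i.d. samples z₁, …, z_T drawn from μ, every f ∈ 𝒳 satisfies |(1/T)·∑_{i=1}^T f(z_i) − ∑_{z∈Z} μ(z)·f(z)| ≤ ε. -/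
open MeasureTheory ProbabilityTheory in
lemma aux_hoeff {Z : Type*} [Fintype Z]
    (μ : Z → ℝ) (hμ0 : ∀ z, 0 ≤ μ z) (hμ1 : ∑ z, μ z = 1)
    (g : Z → ℝ) (a M : ℝ) (hM : 0 < M) (hg : ∀ z, a ≤ g z ∧ g z ≤ a + M) (t : ℝ) :
    ∑ z, μ z * Real.exp (t * (g z - ∑ w, μ w * g w)) ≤ Real.exp (t ^ 2 * M ^ 2 / 8) := by
  letI : MeasurableSpace Z := ⊤
  let P : Measure Z := ∑ z, ENNReal.ofReal (μ z) • Measure.dirac z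
  have hP : IsProbabilityMeasure P := by
    constructor
    simp only [P, Measure.coe_finsetSum, Finset.sum_apply, Measure.smul_apply, measure_univ,
      smul_eq_mul, mul_one]
    rw [← ENNReal.ofReal_sum_of_nonneg (fun z _ => hμ0 z), hμ1, ENNReal.ofReal_one]
  have hint : ∀ h : Z → ℝ, ∫ z, h z ∂P = ∑ z, μ z * h z := by
    intro h
    simp only [P]
    rw [integral_finsetSum_measure]
    · refine Finset.sum_congr rfl fun z _ => ?_
      rw [integral_smul_measure, integral_dirac, ENNReal.toReal_ofReal (hμ0 z), smul_eq_mul]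
    · intro z _
      exact (integrable_dirac (by simp)).smul_measure (by simp)
  have h1 := hasSubgaussianMGF_of_mem_Icc (μ := P) (X := g) (a := a) (b := a + M)
    (measurable_from_top.aemeasurable) (Filter.Eventually.of_forall fun z => ⟨(hg z).1, (hg z).2⟩)
  have h2 := h1.mgf_le t
  rw [mgf, hint, hint] at h2
  refine h2.trans (le_of_eq ?_)
  congr 1
  simp [abs_of_pos hM]
  ring

open Classical in
lemma aux_tail {Z : Type*} [Fintype Z]
    (μ : Z → ℝ) (hμ0 : ∀ z, 0 ≤ μ z) (hμ1 : ∑ z, μ z = 1)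
    (g : Z → ℝ) (a M : ℝ) (hM : 0 < M) (hg : ∀ z, a ≤ g z ∧ g z ≤ a + M)
    (ε : ℝ) (hε : 0 < ε) (T : ℕ) :
    ∑ z : Fin T → Z, (if T * ε < ∑ i, (g (z i) - ∑ w, μ w * g w) then ∏ i, μ (z i) else 0)
      ≤ Real.exp (- (2 * T * ε ^ 2 / M ^ 2)) := by
  set m := ∑ w, μ w * g w with hm
  set s := 4 * ε / M ^ 2 with hs
  have hs0 : 0 < s := by positivity
  have h1 : ∀ z : Fin T → Z, (if T * ε < ∑ i, (g (z i) - m) then ∏ i, μ (z i) else 0)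
      ≤ Real.exp (-(s * (T * ε))) * ∏ i, (μ (z i) * Real.exp (s * (g (z i) - m))) := by
    intro z
    have hp : 0 ≤ ∏ i, μ (z i) := Finset.prod_nonneg fun i _ => hμ0 _
    rw [Finset.prod_mul_distrib, ← Real.exp_sum, ← Finset.mul_sum]
    split_ifs with h
    · have : 1 ≤ Real.exp (-(s * (T * ε))) * Real.exp (s * ∑ i, (g (z i) - m)) := by
        rw [← Real.exp_add]
        apply Real.one_le_exp
        nlinarith
      nlinarith
    · positivity
  refine (Finset.sum_le_sum fun z _ => h1 z).trans ?_
  rw [← Finset.mul_sum]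
  have h2 : ∑ z : Fin T → Z, ∏ i, (μ (z i) * Real.exp (s * (g (z i) - m)))
      = (∑ z, μ z * Real.exp (s * (g z - m))) ^ T := by
    rw [Fintype.sum_pow]
  rw [h2]
  have h3 := aux_hoeff μ hμ0 hμ1 g a M hM hg s
  have h0 : 0 ≤ ∑ z, μ z * Real.exp (s * (g z - m)) :=
    Finset.sum_nonneg fun z _ => mul_nonneg (hμ0 z) (Real.exp_pos _).le
  calc _ ≤ Real.exp (-(s * (T * ε))) * (Real.exp (s ^ 2 * M ^ 2 / 8)) ^ T := by
        gcongr
    _ = _ := by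
        rw [← Real.exp_nat_mul, ← Real.exp_add]
        congr 1
        rw [hs]
        field_simp
        ring

open Classical in
/-- Uniform convergence over a finite class via Hoeffding plus union bound. -/
theorem stmt0
    (Z : Type*) [Fintype Z] [Nonempty Z]
    (μ : Z → ℝ) (hμ0 : ∀ z, 0 ≤ μ z) (hμ1 : ∑ z, μ z = 1)
    (𝒳 : Finset (Z → ℝ)) (h𝒳 : 𝒳.Nonempty)
    (M : ℝ) (hM : ∀ f ∈ 𝒳, ∀ z, 0 ≤ f z ∧ f z ≤ M)
    (ε δ : ℝ) (hε : 0 < ε) (hδ : 1 ≤ δ) (hcard : 2 ≤ (𝒳.card : ℝ) * δ)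
    (T : ℕ) (hT : 0 < T)
    (hTbound : (M ^ 2 / ε ^ 2) * (Real.log 𝒳.card + Real.log δ) ≤ T) :
    1 - 1 / δ ≤ ∑ z : Fin T → Z,
      (if (∀ f ∈ 𝒳, |(1 / (T : ℝ)) * ∑ i, f (z i) - ∑ w, μ w * f w| ≤ ε)
       then ∏ i, μ (z i) else 0) := by
  have hδ0 : 0 < δ := by linarith
  have hT0 : (0 : ℝ) < T := by exact_mod_cast hT
  have hc0 : (0 : ℝ) < 𝒳.card := by exact_mod_cast h𝒳.card_pos
  have htot : ∑ z : Fin T → Z, ∏ i, μ (z i) = 1 := by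
    rw [← Fintype.sum_pow, hμ1, one_pow]
  have hp : ∀ z : Fin T → Z, 0 ≤ ∏ i, μ (z i) := fun z => Finset.prod_nonneg fun i _ => hμ0 _
  obtain ⟨f0, hf0⟩ := h𝒳
  obtain ⟨z0⟩ := ‹Nonempty Z›
  have hM0 : 0 ≤ M := (hM f0 hf0 z0).1.trans (hM f0 hf0 z0).2
  rcases hM0.eq_or_lt with hM0 | hM0
  · have : ∀ f ∈ 𝒳, ∀ z, f z = 0 := fun f hf z =>
      le_antisymm (by rw [hM0]; exact (hM f hf z).2) (hM f hf z).1
    have hall : ∀ z : Fin T → Z,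
        ∀ f ∈ 𝒳, |(1 / (T : ℝ)) * ∑ i, f (z i) - ∑ w, μ w * f w| ≤ ε := by
      intro z f hf
      simp [this f hf, hε.le]
    rw [Finset.sum_congr rfl fun z _ => if_pos (hall z), htot]
    have : 0 < 1 / δ := by positivity
    linarith
  let A : (Z → ℝ) → (Fin T → Z) → ℝ := fun g z =>
    if T * ε < ∑ i, (g (z i) - ∑ w, μ w * g w) then ∏ i, μ (z i) else 0
  have hA0 : ∀ g z, 0 ≤ A g z := by
    intro g z
    simp only [A]
    split_ifs
    · exact hp z
    · exact le_rfl
  have key : ∀ z : Fin T → Z, ∏ i, μ (z i) -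
      ∑ f ∈ 𝒳, (A f z + A (fun w => - f w) z) ≤
      (if (∀ f ∈ 𝒳, |(1 / (T : ℝ)) * ∑ i, f (z i) - ∑ w, μ w * f w| ≤ ε)
       then ∏ i, μ (z i) else 0) := by
    intro z
    split_ifs with h
    · have : 0 ≤ ∑ f ∈ 𝒳, (A f z + A (fun w => - f w) z) :=
        Finset.sum_nonneg fun f _ => add_nonneg (hA0 f z) (hA0 (fun w => - f w) z)
      linarith
    · push Not at h
      obtain ⟨f, hf, hfe⟩ := h
      have h1 : A f z + A (fun w => - f w) z ≤ ∑ f ∈ 𝒳, (A f z + A (fun w => - f w) z) :=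
        Finset.single_le_sum (f := fun f => A f z + A (fun w => - f w) z)
          (fun f _ => add_nonneg (hA0 f z) (hA0 (fun w => - f w) z)) hf
      have h2 : ∏ i, μ (z i) ≤ A f z + A (fun w => - f w) z := by
        have e : ∑ i, f (z i) = T * (1 / (T : ℝ) * ∑ i, f (z i)) := by field_simp
        rcases lt_abs.1 hfe with h | h
        · have : A f z = ∏ i, μ (z i) := by
            apply if_pos
            rw [Finset.sum_sub_distrib, e]
            simp only [Finset.sum_const, Finset.card_univ, Fintype.card_fin, nsmul_eq_mul]
            rw [← mul_sub]
            gcongr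
          linarith [hA0 (fun w => - f w) z]
        · have : A (fun w => - f w) z = ∏ i, μ (z i) := by
            apply if_pos
            rw [Finset.sum_sub_distrib]
            simp only [Finset.sum_const, Finset.card_univ, Fintype.card_fin, nsmul_eq_mul,
              mul_neg, Finset.sum_neg_distrib]
            rw [e]
            nlinarith
          linarith [hA0 f z]
      linarith
  refine le_trans ?_ (Finset.sum_le_sum fun z _ => key z)
  rw [Finset.sum_sub_distrib, htot, Finset.sum_comm]
  set E := Real.exp (- (2 * T * ε ^ 2 / M ^ 2)) with hE
  have hb : ∑ f ∈ 𝒳, ∑ z, (A f z + A (fun w => - f w) z) ≤ ∑ f ∈ 𝒳, (E + E) := by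
    refine Finset.sum_le_sum fun f hf => ?_
    rw [Finset.sum_add_distrib]
    refine add_le_add ?_ ?_
    · exact aux_tail μ hμ0 hμ1 f 0 M hM0 (fun z => by simpa using hM f hf z) ε hε T
    · exact aux_tail μ hμ0 hμ1 (fun w => - f w) (-M) M hM0
        (fun z => by have := hM f hf z; constructor <;> linarith) ε hε T
  rw [Finset.sum_const, nsmul_eq_mul] at hb
  have hEle : E ≤ 1 / (𝒳.card * δ) ^ 2 := by
    have hl : Real.log (𝒳.card * δ) ≤ T * ε ^ 2 / M ^ 2 := by
      rw [Real.log_mul hc0.ne' hδ0.ne', le_div_iff₀ (by positivity)]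
      rw [div_mul_eq_mul_div, div_le_iff₀ (by positivity)] at hTbound
      linarith
    have : (1 : ℝ) / (𝒳.card * δ) ^ 2 = Real.exp (-(2 * Real.log (𝒳.card * δ))) := by
      rw [Real.exp_neg, two_mul, Real.exp_add, Real.exp_log (by positivity), one_div, sq]
    rw [this, hE]
    apply Real.exp_le_exp.2
    have : 2 * T * ε ^ 2 / M ^ 2 = 2 * (T * ε ^ 2 / M ^ 2) := by ring
    linarith
  have hfin : (𝒳.card : ℝ) * (E + E) ≤ 1 / δ := by
    calc (𝒳.card : ℝ) * (E + E) ≤ 𝒳.card * (1 / (𝒳.card * δ) ^ 2 + 1 / (𝒳.card * δ) ^ 2) := by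
          gcongr
      _ = (2 / (𝒳.card * δ)) * (1 / δ) := by field_simp; ring
      _ ≤ 1 * (1 / δ) := by
          gcongr
          rw [div_le_one (by positivity)]
          exact hcard
      _ = 1 / δ := one_mul _
  linarith
end

section
/- Let X be a nonempty finite set, let p : X → ℝ be a nonnegative function with max_{x∈X} p(x) > 0, let T be a positive integer, and let ε > 0. Define Bad = { h ∈ X : (1 + 1/ε) · p(h) < max_{x∈X} p(x) }. Then ∑_{h∈Bad} p(h)^T / ∑_{x∈X} p(x)^T ≤ |X| · (1 + 1/ε)^{−T}. -/
open Classical in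
/-- Posterior mass of "bad" (sub-maximum-likelihood) hypotheses is at most
`|X| · (1 + 1/ε)^{-T}`. -/
theorem stmt1
    (X : Type*) [Fintype X] [Nonempty X]
    (p : X → ℝ) (hp : ∀ x, 0 ≤ p x)
    (hmax : 0 < Finset.univ.sup' Finset.univ_nonempty p)
    (T : ℕ) (hT : 0 < T) (ε : ℝ) (hε : 0 < ε) :
    (∑ h ∈ Finset.univ.filter
        (fun h : X => (1 + 1 / ε) * p h < Finset.univ.sup' Finset.univ_nonempty p),
        p h ^ T) / (∑ x, p x ^ T)
      ≤ (Fintype.card X : ℝ) * ((1 + 1 / ε) ^ T)⁻¹ := by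
  obtain ⟨m, -, hm⟩ := Finset.exists_mem_eq_sup' Finset.univ_nonempty p
  rw [hm] at hmax ⊢
  have hc : 0 < 1 + 1 / ε := by positivity
  generalize 1 + 1 / ε = c at hc ⊢
  have hmS : p m ^ T ≤ ∑ x, p x ^ T :=
    Finset.single_le_sum (f := fun x => p x ^ T)
      (fun x _ => pow_nonneg (hp x) T) (Finset.mem_univ m)
  have hS : 0 < ∑ x, p x ^ T := lt_of_lt_of_le (pow_pos hmax T) hmS
  rw [div_le_iff₀ hS]
  have h1 : ∀ h ∈ Finset.univ.filter (fun h : X => c * p h < p m),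
      p h ^ T ≤ (c ^ T)⁻¹ * ∑ x, p x ^ T := by
    intro h hh
    have hlt := (Finset.mem_filter.mp hh).2
    rw [← div_eq_inv_mul, le_div_iff₀ (pow_pos hc T), mul_comm, ← mul_pow]
    exact (pow_le_pow_left₀ (mul_nonneg hc.le (hp h)) hlt.le T).trans hmS
  have h2 := Finset.sum_le_card_nsmul _ _ _ h1
  rw [nsmul_eq_mul] at h2
  refine h2.trans ?_
  rw [mul_assoc]
  refine mul_le_mul_of_nonneg_right ?_ (by positivity)
  exact_mod_cast Finset.card_le_univ _
end

section
/- Let X be a nonempty finite set, let p : X → ℝ be a nonnegative function with max_{x∈X} p(x) > 0, let ε > 0 and δ > 0 be reals, and let T be a positive integer with T ≥ (δ + log₂|X|) / log₂(1 + 1/ε). Define Bad = { h ∈ X : (1 + 1/ε) · p(h) < max_{x∈X} p(x) }. Then ∑_{h∈Bad} p(h)^T / ∑_{x∈X} p(x)^T ≤ 2^{−δ}. -/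
open Classical in
/-- For `T` above the stated threshold, the posterior mass of "bad"
hypotheses is at most `2^{-δ}`. -/
theorem stmt2
    (X : Type*) [Fintype X] [Nonempty X]
    (p : X → ℝ) (hp : ∀ x, 0 ≤ p x)
    (hmax : 0 < Finset.univ.sup' Finset.univ_nonempty p)
    (ε δ : ℝ) (hε : 0 < ε) (hδ : 0 < δ)
    (T : ℕ) (hT : 0 < T)
    (hTbound : (δ + Real.logb 2 (Fintype.card X)) / Real.logb 2 (1 + 1 / ε) ≤ T) :
    (∑ h ∈ Finset.univ.filter
        (fun h : X => (1 + 1 / ε) * p h < Finset.univ.sup' Finset.univ_nonempty p),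
        p h ^ T) / (∑ x, p x ^ T)
      ≤ (2 : ℝ) ^ (-δ) := by
  obtain ⟨m, -, hm⟩ := Finset.exists_mem_eq_sup' (Finset.univ_nonempty (α := X)) p
  set M := Finset.univ.sup' Finset.univ_nonempty p with hM
  set c : ℝ := 1 + 1 / ε with hc
  have hc1 : 1 < c := by
    have : 0 < 1 / ε := by positivity
    linarith
  have hc0 : 0 < c := by linarith
  have hN : (0 : ℝ) < Fintype.card X := by exact_mod_cast Fintype.card_pos
  have hS : M ^ T ≤ ∑ x, p x ^ T := by
    rw [hm]
    exact Finset.single_le_sum (f := fun x => p x ^ T)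
      (fun x _ => pow_nonneg (hp x) T) (Finset.mem_univ m)
  have hSpos : 0 < ∑ x, p x ^ T := lt_of_lt_of_le (pow_pos hmax T) hS
  have hlog : 0 < Real.logb 2 c := Real.logb_pos (by norm_num) hc1
  rw [div_le_iff₀ hlog] at hTbound
  have key : (2 : ℝ) ^ δ * Fintype.card X ≤ c ^ T := by
    have h1 : (2 : ℝ) ^ (δ + Real.logb 2 (Fintype.card X)) ≤ 2 ^ (T * Real.logb 2 c) :=
      Real.rpow_le_rpow_of_exponent_le (by norm_num) hTbound
    rwa [Real.rpow_add (by norm_num), Real.rpow_logb (by norm_num) (by norm_num) hN,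
      mul_comm (T : ℝ), Real.rpow_mul (by norm_num),
      Real.rpow_logb (by norm_num) (by norm_num) hc0, Real.rpow_natCast] at h1
  set B := ∑ h ∈ Finset.univ.filter (fun h : X => c * p h < M), p h ^ T with hB
  have hB0 : 0 ≤ B := Finset.sum_nonneg fun x _ => pow_nonneg (hp x) T
  have hBle : c ^ T * B ≤ Fintype.card X * M ^ T := by
    rw [hB, Finset.mul_sum]
    calc _ ≤ ∑ h ∈ Finset.univ.filter (fun h : X => c * p h < M), M ^ T := by
            apply Finset.sum_le_sum
            intro h hh
            rw [← mul_pow]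
            exact pow_le_pow_left₀ (mul_nonneg hc0.le (hp h)) (Finset.mem_filter.mp hh).2.le T
      _ ≤ ∑ h : X, M ^ T :=
            Finset.sum_le_sum_of_subset_of_nonneg (Finset.filter_subset _ _)
              (fun _ _ _ => pow_nonneg hmax.le T)
      _ = _ := by simp
  have h2 : (0 : ℝ) < 2 ^ δ := by positivity
  rw [Real.rpow_neg (by norm_num), div_le_iff₀ hSpos, inv_mul_eq_div, le_div_iff₀ h2]
  have h3 := mul_le_mul_of_nonneg_right key hB0
  have h4 := mul_le_mul_of_nonneg_left hS hN.le
  refine le_of_mul_le_mul_left ?_ hN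
  linarith
end

section
/- Let d be a positive integer and let u, v ∈ ℂ^d be unit vectors, i.e. ∑_i |u_i|² = 1 and ∑_i |v_i|² = 1. Let A be the d×d complex matrix with entries A(i,j) = u_i · conj(u_j) − v_i · conj(v_j) (the difference of the outer products uu* − vv*). Then A is Hermitian, and the sum of the absolute values of its d real eigenvalues (counted with multiplicity, as given by the spectral theorem for Hermitian matrices) equals √2 · ‖A‖_F, where ‖A‖_F = √(∑_{i,j} |A(i,j)|²) is the Frobenius norm of A. -/
lemma aux_rank {d : ℕ} (A B : Matrix (Fin d) (Fin d) ℂ) : (A + B).rank ≤ A.rank + B.rank := by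
  unfold Matrix.rank
  rw [Matrix.mulVecLin_add]
  refine le_trans (Submodule.finrank_mono ?_) (Submodule.finrank_add_le_finrank_add_finrank _ _)
  rintro _ ⟨x, rfl⟩
  exact Submodule.add_mem_sup ⟨x, rfl⟩ ⟨x, rfl⟩

lemma aux_sum {d : ℕ} (f : Fin d → ℝ) (h : Fintype.card {i // f i ≠ 0} ≤ 2) (h0 : ∑ i, f i = 0) :
    ∑ i, |f i| = Real.sqrt 2 * Real.sqrt (∑ i, f i ^ 2) := by
  classical
  set S := Finset.univ.filter (fun i => f i ≠ 0) with hS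
  have hz : ∀ i, i ∉ S → f i = 0 := by
    intro i hi
    simpa [hS] using hi
  have hc : S.card ≤ 2 := by
    rw [Fintype.card_subtype] at h
    exact h
  have e (g : ℝ → ℝ) (hg : g 0 = 0) : ∑ i, g (f i) = ∑ i ∈ S, g (f i) := by
    symm
    apply Finset.sum_subset (Finset.subset_univ _)
    intro i _ hi
    rw [hz i hi, hg]
  have e1 := e (fun x => x) rfl
  have e2 := e (fun x => |x|) (by simp)
  have e3 := e (fun x => x ^ 2) (by simp)
  rw [e2, e3]
  rw [e1] at h0
  rw [← Real.sqrt_mul (by norm_num)]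
  have : S.card = 0 ∨ S.card = 1 ∨ S.card = 2 := by omega
  rcases this with hh | hh | hh
  · rw [Finset.card_eq_zero] at hh
    rw [hh]; simp
  · obtain ⟨a, ha⟩ := Finset.card_eq_one.1 hh
    rw [ha] at h0 ⊢
    simp only [Finset.sum_singleton] at h0 ⊢
    simp [h0]
  · obtain ⟨a, b, hab, ha⟩ := Finset.card_eq_two.1 hh
    rw [ha] at h0 ⊢
    rw [Finset.sum_pair hab] at h0
    rw [Finset.sum_pair hab, Finset.sum_pair hab]
    have hb : f b = - f a := by linarith
    rw [hb, abs_neg, show 2 * (f a ^ 2 + (- f a) ^ 2) = (2 * f a) ^ 2 by ring, Real.sqrt_sq_eq_abs,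
      abs_mul]
    norm_num
    ring

lemma aux_sq {d : ℕ} (A : Matrix (Fin d) (Fin d) ℂ) (hA : A.IsHermitian) :
    ∑ i, hA.eigenvalues i ^ 2 = ∑ i, ∑ j, ‖A i j‖ ^ 2 := by
  have h1 : (A * A).trace = ((∑ i, hA.eigenvalues i ^ 2 : ℝ) : ℂ) := by
    conv_lhs => rw [hA.spectral_theorem, ← map_mul, Unitary.conjStarAlgAut_apply,
      Matrix.trace_mul_comm, ← mul_assoc]
    simp [Matrix.trace, pow_two]
  have h2 : (A * A).trace = ((∑ i, ∑ j, ‖A i j‖ ^ 2 : ℝ) : ℂ) := by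
    simp only [Matrix.trace, Matrix.diag, Matrix.mul_apply]
    push_cast
    refine Finset.sum_congr rfl fun i _ => Finset.sum_congr rfl fun j _ => ?_
    rw [← hA.apply j i]
    exact Complex.mul_conj' _
  exact_mod_cast h1.symm.trans h2

/-- For pure states `ρ₀ = uu*`, `ρ₁ = vv*`, we have
`‖ρ₀ − ρ₁‖₁ = √2 · ‖ρ₀ − ρ₁‖_F`. -/
theorem stmt6
    (d : ℕ) (hd : 0 < d) (u v : Fin d → ℂ)
    (hu : ∑ i, ‖u i‖ ^ 2 = 1) (hv : ∑ i, ‖v i‖ ^ 2 = 1)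
    (A : Matrix (Fin d) (Fin d) ℂ)
    (hA : ∀ i j, A i j = u i * star (u j) - v i * star (v j)) :
    ∃ hHerm : A.IsHermitian,
      ∑ i, |hHerm.eigenvalues i|
        = Real.sqrt 2 * Real.sqrt (∑ i, ∑ j, ‖A i j‖ ^ 2) := by
  have hH : A.IsHermitian := by
    ext i j
    rw [Matrix.conjTranspose_apply, hA, hA]
    simp [mul_comm]
  refine ⟨hH, ?_⟩
  rw [← aux_sq A hH]
  apply aux_sum
  · rw [← hH.rank_eq_card_non_zero_eigs]
    have : A = Matrix.vecMulVec u (star u) + Matrix.vecMulVec (-v) (star v) := by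
      ext i j
      simp [hA, Matrix.vecMulVec_apply, sub_eq_add_neg]
    rw [this]
    have h1 := Matrix.rank_vecMulVec_le u (star u)
    have h2 := Matrix.rank_vecMulVec_le (-v) (star v)
    have h3 := aux_rank (Matrix.vecMulVec u (star u)) (Matrix.vecMulVec (-v) (star v))
    omega
  · have h := hH.trace_eq_sum_eigenvalues
    have t (w : Fin d → ℂ) (hw : ∑ i, ‖w i‖ ^ 2 = 1) : ∑ i, w i * star (w i) = 1 := by
      have : ((∑ i, ‖w i‖ ^ 2 : ℝ) : ℂ) = 1 := by rw [hw]; simp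
      rw [← this]
      push_cast
      exact Finset.sum_congr rfl fun i _ => Complex.mul_conj' _
    have h' : A.trace = 0 := by
      simp only [Matrix.trace, Matrix.diag, hA]
      rw [Finset.sum_sub_distrib, t u hu, t v hv, sub_self]
    rw [h'] at h
    have h2 : ((∑ i, hH.eigenvalues i : ℝ) : ℂ) = 0 := by
      rw [h]; push_cast; rfl
    exact Complex.ofReal_eq_zero.1 h2
end

section
/- Let X and Z be nonempty finite sets, let c be a real with 0 < c ≤ 1, and for each s ∈ X let P_s be a probability mass function on Z with P_s(z) ≥ c for all z ∈ Z; set M = log(1/c). Fix x ∈ X, a real ε > 0, and a real δ ≥ 1 with |X|·δ ≥ 2, and let T be a positive integer with T ≥ 16·ε²·M²·(log|X| + log δ) (natural logarithms). Then with probability at least 1 − 1/δ over T i.i.d. samples z₁, …, z_T drawn from P_x, the following holds: every h ∈ X satisfying ∏_{i=1}^T P_h(z_i) ≥ exp(−T/(2ε)) · max_{s∈X} ∏_{i=1}^T P_s(z_i) also satisfies, for every y ∈ X, ∑_{z∈Z} P_x(z)·log(P_y(z)/P_h(z)) ≤ 1/ε; in particular, taking y = x, the Kullback–Leibler divergence D_KL(P_x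 ‖ P_h) = ∑_{z∈Z} P_x(z)·log(P_x(z)/P_h(z)) is at most 1/ε. -/
open MeasureTheory ProbabilityTheory in
theorem hoeff_mgf {Z : Type*} [Fintype Z] (p f : Z → ℝ) (hp : ∀ z, 0 ≤ p z)
    (hp1 : ∑ z, p z = 1) (a b : ℝ) (hf : ∀ z, f z ∈ Set.Icc a b) (l : ℝ) :
    ∑ z, p z * Real.exp (l * (f z - ∑ w, p w * f w)) ≤ Real.exp (l ^ 2 * (b - a) ^ 2 / 8) := by
  letI : MeasurableSpace Z := ⊤
  let μ : Measure Z := ∑ z, ENNReal.ofReal (p z) • Measure.dirac z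
  have hint : ∀ g : Z → ℝ, ∫ z, g z ∂μ = ∑ z, p z * g z := by
    intro g
    simp only [μ]
    rw [integral_finsetSum_measure]
    · refine Finset.sum_congr rfl fun z _ => ?_
      rw [integral_smul_measure, integral_dirac, ENNReal.toReal_ofReal (hp z), smul_eq_mul]
    · intro z _
      exact Integrable.smul_measure (integrable_dirac (by simp)) (by simp)
  haveI : IsProbabilityMeasure μ := by
    constructor
    simp only [μ]
    simp only [Measure.coe_finset_sum, Finset.sum_apply, Measure.smul_apply, measure_univ, smul_eq_mul, mul_one]
    rw [← ENNReal.ofReal_sum_of_nonneg (fun z _ => hp z), hp1, ENNReal.ofReal_one]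
  have h := (hasSubgaussianMGF_of_mem_Icc (μ := μ) (X := f) (a := a) (b := b)
    (measurable_from_top.aemeasurable) (Filter.Eventually.of_forall hf)).mgf_le l
  rw [mgf, hint, hint] at h
  refine h.trans (le_of_eq ?_)
  congr 1
  simp only [NNReal.coe_pow, NNReal.coe_div, coe_nnnorm, Real.norm_eq_abs, div_pow, sq_abs,
    NNReal.coe_ofNat]
  ring

open Classical in
theorem hoeff_tail {Z : Type*} [Fintype Z] (p f : Z → ℝ) (hp : ∀ z, 0 ≤ p z)
    (hp1 : ∑ z, p z = 1) (a b : ℝ) (hab : a < b) (hf : ∀ z, f z ∈ Set.Icc a b) (t : ℝ)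
    (ht : 0 ≤ t) (T : ℕ) :
    ∑ z : Fin T → Z, (if (T : ℝ) * t ≤ ∑ i, (f (z i) - ∑ w, p w * f w)
      then ∏ i, p (z i) else 0) ≤ Real.exp (- (2 * T * t ^ 2 / (b - a) ^ 2)) := by
  have hba : 0 < b - a := sub_pos.2 hab
  set m := ∑ w, p w * f w with hm
  set l : ℝ := 4 * t / (b - a) ^ 2 with hl
  have hl0 : 0 ≤ l := by positivity
  calc _ ≤ ∑ z : Fin T → Z, Real.exp (-(l * (T * t))) *
            ∏ i, (p (z i) * Real.exp (l * (f (z i) - m))) := by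
          refine Finset.sum_le_sum fun z _ => ?_
          have h0 : 0 ≤ ∏ i, p (z i) := Finset.prod_nonneg fun i _ => hp _
          rw [Finset.prod_mul_distrib, ← Real.exp_sum, ← Finset.mul_sum, mul_left_comm,
            ← Real.exp_add]
          split_ifs with h
          · refine le_mul_of_one_le_right h0 (Real.one_le_exp ?_)
            have := mul_le_mul_of_nonneg_left h hl0
            linarith
          · positivity
    _ = Real.exp (-(l * (T * t))) * (∑ z, p z * Real.exp (l * (f z - m))) ^ T := by
          rw [← Finset.mul_sum, Fintype.sum_pow]
    _ ≤ Real.exp (-(l * (T * t))) * (Real.exp (l ^ 2 * (b - a) ^ 2 / 8)) ^ T := by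
          gcongr
          · exact Finset.sum_nonneg fun z _ => mul_nonneg (hp z) (Real.exp_pos _).le
          · exact hoeff_mgf p f hp hp1 a b hf l
    _ = _ := by
          rw [← Real.exp_nat_mul, ← Real.exp_add]
          congr 1
          rw [hl]
          field_simp
          ring

open Classical in
/-- Approximate empirical maximum-likelihood hypotheses over a finite class of
everywhere-`c`-bounded-below distributions are close in KL divergence to the
true distribution. -/
theorem stmt9
    (X Z : Type*) [Fintype X] [Nonempty X] [Fintype Z] [Nonempty Z]
    (c : ℝ) (hc0 : 0 < c) (hc1 : c ≤ 1)
    (P : X → Z → ℝ) (hPc : ∀ s z, c ≤ P s z) (hP1 : ∀ s, ∑ z, P s z = 1)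
    (M : ℝ) (hM : M = Real.log (1 / c))
    (x : X) (ε δ : ℝ) (hε : 0 < ε) (hδ : 1 ≤ δ)
    (hcard : 2 ≤ (Fintype.card X : ℝ) * δ)
    (T : ℕ) (hT : 0 < T)
    (hTbound : 16 * ε ^ 2 * M ^ 2 * (Real.log (Fintype.card X) + Real.log δ) ≤ T) :
    1 - 1 / δ ≤ ∑ z : Fin T → Z,
      (if (∀ h : X,
            Real.exp (-(T : ℝ) / (2 * ε)) *
              (Finset.univ.sup' Finset.univ_nonempty (fun s : X => ∏ i, P s (z i)))
              ≤ ∏ i, P h (z i) →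
            ((∀ y : X, ∑ w, P x w * Real.log (P y w / P h w) ≤ 1 / ε) ∧
              ∑ w, P x w * Real.log (P x w / P h w) ≤ 1 / ε))
       then ∏ i, P x (z i) else 0) := by
  have hpos : ∀ s z, 0 < P s z := fun s z => hc0.trans_le (hPc s z)
  have hle1 : ∀ s z, P s z ≤ 1 := fun s z => by
    rw [← hP1 s]
    exact Finset.single_le_sum (f := P s) (fun i _ => (hpos s i).le) (Finset.mem_univ z)
  have hM' : M = - Real.log c := by rw [hM, one_div, Real.log_inv]
  have hlog : ∀ s z, Real.log (P s z) ∈ Set.Icc (-M) 0 := fun s z =>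
    ⟨by rw [hM', neg_neg]; exact Real.log_le_log hc0 (hPc s z),
      Real.log_nonpos (hpos s z).le (hle1 s z)⟩
  have hM0 : 0 ≤ M := by rw [hM']; linarith [Real.log_nonpos hc0.le hc1]
  have htot : ∑ z : Fin T → Z, ∏ i, P x (z i) = 1 := by
    rw [← Fintype.sum_pow, hP1, one_pow]
  have hδ0 : 0 < δ := by linarith
  set m : X → ℝ := fun s => ∑ w, P x w * Real.log (P s w) with hm
  have hTR : (0 : ℝ) < T := by exact_mod_cast hT
  have hkl : ∀ y h, ∑ w, P x w * Real.log (P y w / P h w) = m y - m h := by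
    intro y h
    simp only [hm]
    rw [← Finset.sum_sub_distrib]
    refine Finset.sum_congr rfl fun w _ => ?_
    rw [Real.log_div (hpos y w).ne' (hpos h w).ne']; ring
  simp only [hkl]
  rcases hM0.eq_or_lt with hMz | hMpos
  · have hz : ∀ s, m s = 0 := fun s => by
      refine Finset.sum_eq_zero fun w _ => ?_
      have h := hlog s w
      rw [← hMz, neg_zero, Set.Icc_self, Set.mem_singleton_iff] at h
      rw [h, mul_zero]
    have : (0:ℝ) ≤ 1 / ε := by positivity
    simp only [hz, sub_self, this, implies_true, and_self, if_true, htot]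
    have : (0:ℝ) ≤ 1 / δ := by positivity
    linarith
  set t : ℝ := 1 / (4 * ε) with ht
  have ht0 : 0 ≤ t := by positivity
  set B := Real.exp (- (2 * T * t ^ 2 / M ^ 2)) with hB
  have hup : ∀ s, ∑ z : Fin T → Z, (if (T : ℝ) * t ≤ ∑ i, (Real.log (P s (z i)) - m s)
      then ∏ i, P x (z i) else 0) ≤ B := fun s => by
    have := hoeff_tail (P x) (fun w => Real.log (P s w)) (fun z => (hpos x z).le) (hP1 x)
      (-M) 0 (by linarith) (hlog s) t ht0 T
    simpa using this
  have hdn : ∀ s, ∑ z : Fin T → Z, (if (T : ℝ) * t ≤ ∑ i, (m s - Real.log (P s (z i)))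
      then ∏ i, P x (z i) else 0) ≤ B := fun s => by
    have := hoeff_tail (P x) (fun w => -Real.log (P s w)) (fun z => (hpos x z).le) (hP1 x)
      0 M hMpos (fun z => ⟨by linarith [(hlog s z).2], by linarith [(hlog s z).1]⟩) t ht0 T
    have e : ∀ u : ℝ, -u - ∑ w, P x w * -Real.log (P s w) = m s - u := fun u => by
      simp only [hm, mul_neg, Finset.sum_neg_distrib]; ring
    simp only [e, sub_zero] at this
    exact this
  set N : ℝ := (Fintype.card X : ℝ) with hN
  have hN0 : 0 < N := by rw [hN]; exact_mod_cast Fintype.card_pos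
  have hBle : N * (2 * B) ≤ 1 / δ := by
    have hB2 : B ≤ ((N * δ) ^ 2)⁻¹ := by
      have h1 : ((N * δ) ^ 2)⁻¹ = Real.exp (-(2 * (Real.log N + Real.log δ))) := by
        rw [Real.exp_neg, ← Real.log_mul hN0.ne' hδ0.ne', two_mul, Real.exp_add,
          Real.exp_log (by positivity), sq]
      rw [h1, hB]
      refine Real.exp_le_exp.2 (neg_le_neg ?_)
      rw [ht, le_div_iff₀ (by positivity)]
      have : 2 * (T:ℝ) * (1 / (4 * ε)) ^ 2 = T / (8 * ε ^ 2) := by field_simp; ring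
      rw [this, le_div_iff₀ (by positivity)]
      linarith
    calc N * (2 * B) ≤ N * (2 * ((N * δ) ^ 2)⁻¹) := by gcongr
      _ ≤ N * ((N * δ) * ((N * δ) ^ 2)⁻¹) := by gcongr
      _ = 1 / δ := by field_simp
  have key : ∀ z : Fin T → Z, ∏ i, P x (z i) ≤
      (if (∀ h : X,
            Real.exp (-(T : ℝ) / (2 * ε)) *
              (Finset.univ.sup' Finset.univ_nonempty (fun s : X => ∏ i, P s (z i)))
              ≤ ∏ i, P h (z i) →
            ((∀ y : X, m y - m h ≤ 1 / ε) ∧ m x - m h ≤ 1 / ε))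
       then ∏ i, P x (z i) else 0) +
      ∑ s, ((if (T : ℝ) * t ≤ ∑ i, (Real.log (P s (z i)) - m s)
          then ∏ i, P x (z i) else 0) +
        (if (T : ℝ) * t ≤ ∑ i, (m s - Real.log (P s (z i)))
          then ∏ i, P x (z i) else 0)) := by
    intro z
    have hq : 0 ≤ ∏ i, P x (z i) := Finset.prod_nonneg fun i _ => (hpos _ _).le
    have hnn : ∀ (p : Prop) [Decidable p], 0 ≤ (if p then ∏ i, P x (z i) else 0) := fun p _ => by
      split_ifs <;> simp [hq]
    have hsn : ∀ s ∈ Finset.univ, 0 ≤ ((if (T : ℝ) * t ≤ ∑ i, (Real.log (P s (z i)) - m s)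
          then ∏ i, P x (z i) else 0) +
        (if (T : ℝ) * t ≤ ∑ i, (m s - Real.log (P s (z i)))
          then ∏ i, P x (z i) else 0)) := fun s _ => add_nonneg (hnn _) (hnn _)
    by_cases hbad : ∃ s, (T : ℝ) * t ≤ ∑ i, (Real.log (P s (z i)) - m s) ∨
        (T : ℝ) * t ≤ ∑ i, (m s - Real.log (P s (z i)))
    · obtain ⟨s, hs⟩ := hbad
      refine le_trans ?_ (le_add_of_nonneg_left (hnn _))
      refine le_trans ?_ (Finset.single_le_sum hsn (Finset.mem_univ s))
      rcases hs with hs | hs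
      · rw [if_pos hs]; exact le_add_of_nonneg_right (hnn _)
      · rw [if_pos hs]; exact le_add_of_nonneg_left (hnn _)
    · push Not at hbad
      refine le_trans ?_ (le_add_of_nonneg_right (Finset.sum_nonneg hsn))
      suffices H : ∀ h : X,
            Real.exp (-(T : ℝ) / (2 * ε)) *
              (Finset.univ.sup' Finset.univ_nonempty (fun s : X => ∏ i, P s (z i)))
              ≤ ∏ i, P h (z i) → ∀ y : X, m y - m h ≤ 1 / ε by
        rw [if_pos fun h hh => ⟨H h hh, H h hh x⟩]
      intro h hh y
      have h1 : Real.exp (-(T : ℝ) / (2 * ε)) * ∏ i, P y (z i) ≤ ∏ i, P h (z i) :=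
        le_trans (mul_le_mul_of_nonneg_left
          (Finset.le_sup' (fun s : X => ∏ i, P s (z i)) (Finset.mem_univ y))
          (Real.exp_pos _).le) hh
      have hpp : ∀ s, 0 < ∏ i, P s (z i) := fun s => Finset.prod_pos fun i _ => hpos _ _
      have h2 := Real.log_le_log (mul_pos (Real.exp_pos _) (hpp y)) h1
      rw [Real.log_mul (Real.exp_pos _).ne' (hpp y).ne', Real.log_exp,
        Real.log_prod (fun i _ => (hpos _ _).ne'), Real.log_prod (fun i _ => (hpos _ _).ne')] at h2
      have h3 := (hbad h).1
      have h4 := (hbad y).2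
      simp only [Finset.sum_sub_distrib, Finset.sum_const, Finset.card_univ, Fintype.card_fin,
        nsmul_eq_mul] at h3 h4
      have e1 : -(T:ℝ) / (2 * ε) = - (T * (2 * t)) := by rw [ht]; field_simp; ring
      have e2 : 1 / ε = 4 * t := by rw [ht]; field_simp
      rw [e1] at h2
      rw [e2]
      refine le_of_mul_le_mul_left ?_ hTR
      linarith
  have hsum := Finset.sum_le_sum fun z (_ : z ∈ Finset.univ) => key z
  rw [htot, Finset.sum_add_distrib, Finset.sum_comm (s := Finset.univ) (t := (Finset.univ : Finset X))] at hsum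
  have hS : ∑ s : X, ∑ z : Fin T → Z, ((if (T : ℝ) * t ≤ ∑ i, (Real.log (P s (z i)) - m s)
          then ∏ i, P x (z i) else 0) +
        (if (T : ℝ) * t ≤ ∑ i, (m s - Real.log (P s (z i)))
          then ∏ i, P x (z i) else 0)) ≤ N * (2 * B) := by
    calc _ ≤ ∑ s : X, 2 * B := by
          refine Finset.sum_le_sum fun s _ => ?_
          rw [Finset.sum_add_distrib]
          linarith [hup s, hdn s]
      _ = N * (2 * B) := by simp [hN]
  linarith
end

section
/- Let X and Z be nonempty finite sets, let c be a real with 0 < c ≤ 1, and for each s ∈ X let P_s be a probability mass function on Z with P_s(z) ≥ c for all z ∈ Z; set M = log(1/c). Fix x ∈ X, a real ε > 0, and a real δ ≥ 1 with |X|·δ ≥ 2, and let T be a positive integer with T ≥ 16·ε²·M²·(log|X| + log δ) (natural logarithms). Then with probability at least 1 − 1/δ over T i.i.d. samples z₁, …, z_T drawn from P_x, every h ∈ X satisfying ∏_{i=1}^T P_h(z_i) ≥ exp(−T/(2ε)) · max_{s∈X} ∏_{i=1}^T P_s(z_i) also satisfies (1/2)·∑_{z∈Z} |P_x(z) − P_h(z)|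 ≤ √(1/(2ε)). -/
lemma aux_log (t : ℝ) (ht : 0 < t) :
    (t - 1) * (5 * t + 1) / (2 * t * (t + 2)) ≤ Real.log t := by
  set f : ℝ → ℝ := fun t => Real.log t - (t - 1) * (5 * t + 1) / (2 * t * (t + 2)) with hf
  have hd : ∀ u : ℝ, 0 < u → HasDerivAt f ((u - 1) ^ 3 / (u ^ 2 * (u + 2) ^ 2)) u := by
    intro u hu
    have h1 : HasDerivAt (fun t : ℝ => (t - 1) * (5 * t + 1))
        (1 * (5 * u + 1) + (u - 1) * (5 * 1)) u :=
      ((hasDerivAt_id u).sub_const 1).mul (((hasDerivAt_id u).const_mul 5).add_const 1)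
    have h2 : HasDerivAt (fun t : ℝ => (2 * t) * (t + 2))
        ((2 * 1) * (u + 2) + (2 * u) * 1) u :=
      ((hasDerivAt_id u).const_mul 2).mul ((hasDerivAt_id u).add_const 2)
    have h3 := (Real.hasDerivAt_log hu.ne').sub (h1.div h2 (by positivity))
    refine h3.congr_deriv ?_
    have : u + 2 ≠ 0 := by positivity
    field_simp
    ring
  have hf1 : f 1 = 0 := by simp [hf]
  suffices 0 ≤ f t by simp only [hf] at this; linarith
  rw [← hf1]
  rcases le_total 1 t with h | h
  · have hm : MonotoneOn f (Set.Ici 1) := by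
      apply monotoneOn_of_deriv_nonneg (convex_Ici 1)
      · intro u hu
        exact (hd u (lt_of_lt_of_le one_pos hu)).continuousAt.continuousWithinAt
      · intro u hu
        rw [interior_Ici] at hu
        exact (hd u (lt_trans one_pos hu)).differentiableAt.differentiableWithinAt
      · intro u hu
        rw [interior_Ici] at hu
        have hu' : (1 : ℝ) < u := hu
        rw [(hd u (lt_trans one_pos hu)).deriv]
        have : 0 ≤ u - 1 := by linarith
        positivity
    exact hm (Set.mem_Ici.2 le_rfl) h h
  · have hm : AntitoneOn f (Set.Ioc 0 1) := by
      apply antitoneOn_of_deriv_nonpos (convex_Ioc 0 1)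
      · intro u hu
        exact (hd u hu.1).continuousAt.continuousWithinAt
      · intro u hu
        rw [interior_Ioc] at hu
        exact (hd u hu.1).differentiableAt.differentiableWithinAt
      · intro u hu
        rw [interior_Ioc] at hu
        rw [(hd u hu.1).deriv]
        have h0 : 0 ≤ 1 - u := by linarith [hu.2]
        have : (u - 1) ^ 3 = - (1 - u) ^ 3 := by ring
        rw [this, neg_div]
        have : 0 ≤ (1 - u) ^ 3 / (u ^ 2 * (u + 2) ^ 2) := by positivity
        linarith
    exact hm ⟨ht, h⟩ ⟨one_pos, le_rfl⟩ h

lemma aux_pt (p q : ℝ) (hp : 0 < p) (hq : 0 < q) :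
    3 / 2 * ((p - q) ^ 2 / (p + 2 * q)) ≤ p * Real.log (p / q) - p + q := by
  have h := mul_le_mul_of_nonneg_left (aux_log (p / q) (div_pos hp hq)) hp.le
  have e : p * ((p / q - 1) * (5 * (p / q) + 1) / (2 * (p / q) * (p / q + 2)))
      = 3 / 2 * ((p - q) ^ 2 / (p + 2 * q)) + p - q := by
    have : p + 2 * q ≠ 0 := by positivity
    field_simp
    ring
  linarith

lemma aux_pinsker {Z : Type*} [Fintype Z] (p q : Z → ℝ) (hp : ∀ z, 0 < p z) (hq : ∀ z, 0 < q z)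
    (hp1 : ∑ z, p z = 1) (hq1 : ∑ z, q z = 1) :
    (∑ z, |p z - q z|) ^ 2 ≤ 2 * ∑ z, p z * Real.log (p z / q z) := by
  have h1 : ∑ z, 3 / 2 * ((p z - q z) ^ 2 / (p z + 2 * q z)) ≤
      ∑ z, (p z * Real.log (p z / q z) - p z + q z) :=
    Finset.sum_le_sum fun z _ => aux_pt _ _ (hp z) (hq z)
  rw [← Finset.mul_sum, Finset.sum_add_distrib, Finset.sum_sub_distrib, hp1, hq1] at h1
  have h2 := Finset.sum_sq_le_sum_mul_sum_of_sq_eq_mul Finset.univ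
    (r := fun z => |p z - q z|) (f := fun z => (p z - q z) ^ 2 / (p z + 2 * q z))
    (g := fun z => p z + 2 * q z)
    (fun z _ => by have := hp z; have := hq z; positivity)
    (fun z _ => by have := hp z; have := hq z; positivity)
    (fun z _ => by
      have := hp z; have := hq z
      have : p z + 2 * q z ≠ 0 := by positivity
      rw [sq_abs]; field_simp)
  have h3 : ∑ z, (p z + 2 * q z) = 3 := by
    rw [Finset.sum_add_distrib, ← Finset.mul_sum, hp1, hq1]; norm_num
  rw [h3] at h2
  linarith

lemma aux_mgf {Z : Type*} [Fintype Z] (c : ℝ) (hc0 : 0 < c)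
    (p q : Z → ℝ) (hp : ∀ z, c ≤ p z) (hq : ∀ z, c ≤ q z)
    (hp1 : ∑ z, p z = 1) (hq1 : ∑ z, q z = 1) (M ε : ℝ) (hM : M = Real.log (1 / c)) (hε : 0 < ε)
    (hbad : Real.sqrt (1 / (2 * ε)) < (1 / 2) * ∑ w, |p w - q w|) :
    0 < M ∧ ∑ w, p w * Real.exp (1 / (4 * ε * M ^ 2) * (1 / (2 * ε) - Real.log (p w / q w)))
      ≤ Real.exp (-(1 / (16 * ε ^ 2 * M ^ 2))) := by
  have hp0 : ∀ z, 0 < p z := fun z => hc0.trans_le (hp z)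
  have hq0 : ∀ z, 0 < q z := fun z => hc0.trans_le (hq z)
  have hple : ∀ z, p z ≤ 1 := fun z => by
    rw [← hp1]; exact Finset.single_le_sum (fun i _ => (hp0 i).le) (Finset.mem_univ z)
  have hqle : ∀ z, q z ≤ 1 := fun z => by
    rw [← hq1]; exact Finset.single_le_sum (fun i _ => (hq0 i).le) (Finset.mem_univ z)
  have hY : ∀ z, |Real.log (p z / q z)| ≤ M := by
    intro z
    rw [hM, Real.log_div (hp0 z).ne' (hq0 z).ne', one_div, Real.log_inv, abs_le]
    have := Real.log_le_log hc0 (hp z)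
    have := Real.log_le_log hc0 (hq z)
    have := Real.log_nonpos (hp0 z).le (hple z)
    have := Real.log_nonpos (hq0 z).le (hqle z)
    constructor <;> linarith
  set K := ∑ z, p z * Real.log (p z / q z) with hK
  have hKM : K ≤ M := by
    calc K ≤ ∑ z, p z * M := Finset.sum_le_sum fun z _ =>
          mul_le_mul_of_nonneg_left (le_of_abs_le (hY z)) (hp0 z).le
      _ = M := by rw [← Finset.sum_mul, hp1, one_mul]
  have hKε : 1 / ε < K := by
    have h1 := aux_pinsker p q hp0 hq0 hp1 hq1
    rw [Real.sqrt_lt' (lt_of_le_of_lt (Real.sqrt_nonneg _) hbad)] at hbad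
    have : 1 / ε = 2 * (1 / (2 * ε)) := by field_simp
    rw [this]
    nlinarith
  have hεi : 0 < 1 / ε := by positivity
  have hM0 : 0 < M := by linarith
  refine ⟨hM0, ?_⟩
  obtain ⟨a, ha⟩ : ∃ a, a = 1 / (4 * ε * M) := ⟨_, rfl⟩
  have ha0 : 0 < a := by rw [ha]; positivity
  have e1 : 1 / ε = 4 * a * M := by rw [ha]; field_simp
  have e2 : 1 / (4 * ε * M ^ 2) = a / M := by rw [ha]; field_simp
  have e3 : 1 / (16 * ε ^ 2 * M ^ 2) = a ^ 2 := by rw [ha]; field_simp; norm_num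
  have e4 : 1 / (2 * ε) = 2 * a * M := by rw [ha]; field_simp; norm_num
  rw [e2, e3, e4]
  rw [e1] at hKε
  have ha1 : a ≤ 1 := by nlinarith
  have hb : ∀ w, p w * Real.exp (a / M * (2 * a * M - Real.log (p w / q w))) ≤
      Real.exp (2 * a ^ 2) * (p w * (1 + a ^ 2) - a / M * (p w * Real.log (p w / q w))) := by
    intro w
    have e : a / M * (2 * a * M - Real.log (p w / q w)) =
      2 * a ^ 2 + -(a / M * Real.log (p w / q w)) := by field_simp; ring
    rw [e, Real.exp_add]
    set u := -(a / M * Real.log (p w / q w)) with hu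
    have hua : |u| ≤ a := by
      rw [hu, abs_neg, abs_mul, abs_of_pos (by positivity : 0 < a / M)]
      calc a / M * |Real.log (p w / q w)| ≤ a / M * M :=
            mul_le_mul_of_nonneg_left (hY w) (by positivity)
        _ = a := by field_simp
    have h1 := le_of_abs_le (Real.abs_exp_sub_one_sub_id_le (hua.trans ha1))
    have h2 : u ^ 2 ≤ a ^ 2 := sq_le_sq' (abs_le.1 hua).1 (abs_le.1 hua).2
    have h3 : Real.exp u ≤ 1 + a ^ 2 + u := by linarith
    calc p w * (Real.exp (2 * a ^ 2) * Real.exp u)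
        = Real.exp (2 * a ^ 2) * (p w * Real.exp u) := by ring
      _ ≤ Real.exp (2 * a ^ 2) * (p w * (1 + a ^ 2 + u)) := by
          have := (hp0 w).le
          gcongr
      _ = _ := by rw [hu]; ring
  refine (Finset.sum_le_sum fun w _ => hb w).trans ?_
  rw [← Finset.mul_sum, Finset.sum_sub_distrib, ← Finset.sum_mul, ← Finset.mul_sum, hp1, ← hK]
  have h5 : a / M * (4 * a * M) ≤ a / M * K := by gcongr
  have h6 : a / M * (4 * a * M) = 4 * a ^ 2 := by field_simp
  have h7 := Real.add_one_le_exp (-(3 * a ^ 2))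
  calc Real.exp (2 * a ^ 2) * (1 * (1 + a ^ 2) - a / M * K)
      ≤ Real.exp (2 * a ^ 2) * Real.exp (-(3 * a ^ 2)) := by
        apply mul_le_mul_of_nonneg_left _ (Real.exp_pos _).le; linarith
    _ = Real.exp (-a ^ 2) := by rw [← Real.exp_add]; congr 1; ring

lemma aux_sum_s10 {Z : Type*} [Fintype Z] (T : ℕ) (f : Z → ℝ) :
    ∑ z : Fin T → Z, ∏ i, f (z i) = (∑ w, f w) ^ T := by
  classical
  rw [Fintype.sum_pow]

open Classical in
/-- Approximate empirical maximum-likelihood hypotheses over a finite class of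
everywhere-`c`-bounded-below distributions are close in total variation
distance to the true distribution. -/
theorem stmt10
    (X Z : Type*) [Fintype X] [Nonempty X] [Fintype Z] [Nonempty Z]
    (c : ℝ) (hc0 : 0 < c) (hc1 : c ≤ 1)
    (P : X → Z → ℝ) (hPc : ∀ s z, c ≤ P s z) (hP1 : ∀ s, ∑ z, P s z = 1)
    (M : ℝ) (hM : M = Real.log (1 / c))
    (x : X) (ε δ : ℝ) (hε : 0 < ε) (hδ : 1 ≤ δ)
    (hcard : 2 ≤ (Fintype.card X : ℝ) * δ)
    (T : ℕ) (hT : 0 < T)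
    (hTbound : 16 * ε ^ 2 * M ^ 2 * (Real.log (Fintype.card X) + Real.log δ) ≤ T) :
    1 - 1 / δ ≤ ∑ z : Fin T → Z,
      (if (∀ h : X,
            Real.exp (-(T : ℝ) / (2 * ε)) *
              (Finset.univ.sup' Finset.univ_nonempty (fun s : X => ∏ i, P s (z i)))
              ≤ ∏ i, P h (z i) →
            (1 / 2) * ∑ w, |P x w - P h w| ≤ Real.sqrt (1 / (2 * ε)))
       then ∏ i, P x (z i) else 0) := by
  have hP0 : ∀ s z, 0 < P s z := fun s z => hc0.trans_le (hPc s z)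
  have hδ0 : 0 < δ := by linarith
  have hX0 : (0 : ℝ) < Fintype.card X := by exact_mod_cast Fintype.card_pos
  set B : Finset X := Finset.univ.filter
    (fun h => Real.sqrt (1 / (2 * ε)) < (1 / 2) * ∑ w, |P x w - P h w|) with hB
  obtain ⟨G, hG⟩ : ∃ G : X → Z → ℝ, G = fun h w => P x w *
    Real.exp (1 / (4 * ε * M ^ 2) * (1 / (2 * ε) - Real.log (P x w / P h w))) := ⟨_, rfl⟩
  have hG0 : ∀ h w, 0 ≤ G h w := fun h w => by
    rw [hG]; exact mul_nonneg (hP0 x w).le (Real.exp_pos _).le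
  have key : ∀ z : Fin T → Z, ∏ i, P x (z i) - ∑ h ∈ B, ∏ i, G h (z i) ≤
      (if (∀ h : X,
            Real.exp (-(T : ℝ) / (2 * ε)) *
              (Finset.univ.sup' Finset.univ_nonempty (fun s : X => ∏ i, P s (z i)))
              ≤ ∏ i, P h (z i) →
            (1 / 2) * ∑ w, |P x w - P h w| ≤ Real.sqrt (1 / (2 * ε)))
       then ∏ i, P x (z i) else 0) := by
    intro z
    have hS : ∀ h ∈ B, 0 ≤ ∏ i, G h (z i) := fun h _ => Finset.prod_nonneg fun i _ => hG0 _ _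
    split_ifs with hgood
    · linarith [Finset.sum_nonneg hS]
    · push Not at hgood
      obtain ⟨h, h1, h2⟩ := hgood
      have hmem : h ∈ B := by rw [hB]; simpa using h2
      have h3 := Finset.single_le_sum hS hmem
      suffices ∏ i, P x (z i) ≤ ∏ i, G h (z i) by linarith
      have h4 : Real.exp (-(T : ℝ) / (2 * ε)) * ∏ i, P x (z i) ≤ ∏ i, P h (z i) := by
        refine le_trans (mul_le_mul_of_nonneg_left ?_ (Real.exp_pos _).le) h1
        exact Finset.le_sup' (fun s : X => ∏ i, P s (z i)) (Finset.mem_univ x)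
      have hx0 : 0 < ∏ i, P x (z i) := Finset.prod_pos fun i _ => hP0 _ _
      have h5 := Real.log_le_log (mul_pos (Real.exp_pos _) hx0) h4
      rw [Real.log_mul (Real.exp_pos _).ne' hx0.ne', Real.log_exp,
        Real.log_prod (fun i _ => (hP0 _ _).ne'), Real.log_prod (fun i _ => (hP0 _ _).ne')] at h5
      rw [hG]
      simp only
      rw [Finset.prod_mul_distrib, ← Real.exp_sum, ← Finset.mul_sum, Finset.sum_sub_distrib]
      apply le_mul_of_one_le_right hx0.le
      apply Real.one_le_exp
      apply mul_nonneg (by positivity)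
      have h6 : ∑ i, Real.log (P x (z i) / P h (z i)) =
          ∑ i, Real.log (P x (z i)) - ∑ i, Real.log (P h (z i)) := by
        rw [← Finset.sum_sub_distrib]
        exact Finset.sum_congr rfl fun i _ => Real.log_div (hP0 _ _).ne' (hP0 _ _).ne'
      rw [h6]
      simp only [Finset.sum_const, Finset.card_univ, Fintype.card_fin, nsmul_eq_mul]
      have h7 : -(T : ℝ) / (2 * ε) = -(T * (1 / (2 * ε))) := by ring
      rw [h7] at h5
      linarith
  refine le_trans ?_ (Finset.sum_le_sum fun z _ => key z)
  rw [Finset.sum_sub_distrib, aux_sum_s10, hP1, one_pow, Finset.sum_comm]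
  have hb : ∀ h ∈ B, ∑ z : Fin T → Z, ∏ i, G h (z i) ≤ 1 / (Fintype.card X * δ) := by
    intro h hh
    rw [hB, Finset.mem_filter] at hh
    obtain ⟨hM0, h1⟩ := aux_mgf c hc0 (P x) (P h) (hPc x) (hPc h) (hP1 x) (hP1 h) M ε hM hε hh.2
    rw [aux_sum_s10]
    have h2 : ∑ w, G h w ≤ Real.exp (-(1 / (16 * ε ^ 2 * M ^ 2))) := by rw [hG]; exact h1
    refine (pow_le_pow_left₀ (Finset.sum_nonneg fun w _ => hG0 h w) h2 T).trans ?_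
    rw [← Real.exp_nat_mul, one_div (_ * δ), ← Real.exp_log (mul_pos hX0 hδ0), ← Real.exp_neg,
      Real.log_mul hX0.ne' hδ0.ne']
    apply Real.exp_le_exp.2
    have h3 : Real.log (Fintype.card X) + Real.log δ ≤ T / (16 * ε ^ 2 * M ^ 2) := by
      rw [le_div_iff₀ (by positivity)]; linarith
    have h4 : (T : ℝ) * -(1 / (16 * ε ^ 2 * M ^ 2)) = -(T / (16 * ε ^ 2 * M ^ 2)) := by ring
    linarith
  have h1 := Finset.sum_le_sum hb
  rw [Finset.sum_const, nsmul_eq_mul] at h1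
  have h2 : (B.card : ℝ) ≤ Fintype.card X := by exact_mod_cast Finset.card_le_univ B
  have h3 : (B.card : ℝ) * (1 / (Fintype.card X * δ)) ≤ 1 / δ := by
    calc (B.card : ℝ) * (1 / (Fintype.card X * δ))
        ≤ Fintype.card X * (1 / (Fintype.card X * δ)) := by gcongr
      _ = 1 / δ := by field_simp
  linarith
end

section
/- Let X and Z be nonempty finite sets, and for each s ∈ X let D_s be a probability mass function on Z. For each s ∈ X define the mixed probability mass function P_s on Z by P_s(z) = (1/2)·D_s(z) + 1/(2·|Z|). Fix x ∈ X, a real ε > 0, and a real δ ≥ 1 with |X|·δ ≥ 2, and let T be a positive integer with T ≥ 16·ε²·(log(2·|Z|))²·(log|X| + log δ) (natural logarithms). Then with probability at least 1 − 1/δ over T i.i.d. samples z₁, …, z_T drawn from P_x, every h ∈ X satisfying ∏_{i=1}^T P_h(z_i) ≥ exp(−T/(2ε)) · max_{s∈X} ∏_{i=1}^T P_s(z_i) also satisfies (1/2)·∑_{z∈Z} |D_x(z) − D_h(z)| ≤ √(2/ε). -/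
theorem hoeff_aux {Z : Type*} [Fintype Z] (p f : Z → ℝ) (c : ℝ) (hc : 0 ≤ c)
    (hp0 : ∀ z, 0 ≤ p z) (hp1 : ∑ z, p z = 1) (hf : ∀ z, |f z| ≤ c) :
    ∑ z, p z * Real.exp (f z) ≤ Real.exp (∑ z, p z * f z + c ^ 2 / 2) := by
  classical
  letI : MeasurableSpace Z := ⊤
  have hs : ∑ z, ENNReal.ofReal (p z) = 1 := by
    rw [← ENNReal.ofReal_sum_of_nonneg (fun i _ => hp0 i), hp1, ENNReal.ofReal_one]
  let q : PMF Z := PMF.ofFintype (fun z => ENNReal.ofReal (p z)) hs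
  have hint : ∀ g : Z → ℝ, ∫ z, g z ∂q.toMeasure = ∑ z, p z * g z := by
    intro g
    rw [PMF.integral_eq_sum]
    apply Finset.sum_congr rfl
    intro z _
    simp [q, ENNReal.toReal_ofReal (hp0 z)]
  have h := ProbabilityTheory.hasSubgaussianMGF_of_mem_Icc (μ := q.toMeasure) (X := f)
    (a := -c) (b := c) (measurable_from_top).aemeasurable
    (Filter.Eventually.of_forall fun z => abs_le.1 (hf z))
  have h2 := h.mgf_le 1
  simp only [ProbabilityTheory.mgf] at h2
  rw [hint, hint] at h2
  have e1 : ∑ z, p z * Real.exp (f z)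
      = Real.exp (∑ z, p z * f z) * ∑ z, p z * Real.exp (1 * (f z - ∑ z, p z * f z)) := by
    rw [Finset.mul_sum]
    apply Finset.sum_congr rfl
    intro z _
    rw [one_mul, Real.exp_sub]
    field_simp
  rw [e1, Real.exp_add]
  refine mul_le_mul_of_nonneg_left (h2.trans (le_of_eq ?_)) (Real.exp_pos _).le
  congr 1
  push_cast
  rw [Real.norm_eq_abs, abs_of_nonneg (by linarith)]
  ring

theorem pinsker_aux {Z : Type*} [Fintype Z] (p q : Z → ℝ)
    (hp0 : ∀ z, 0 < p z) (hp1 : ∑ z, p z = 1)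
    (hq0 : ∀ z, 0 < q z) (hq1 : ∑ z, q z = 1) :
    ∑ z, p z * Real.log (q z / p z) ≤ - (∑ z, |p z - q z|) ^ 2 / 2 := by
  classical
  set V := ∑ z, |p z - q z| with hV
  have hV0 : 0 ≤ V := Finset.sum_nonneg fun _ _ => abs_nonneg _
  let s : Z → ℝ := fun z => if q z ≤ p z then 1 else -1
  have hs : ∀ z, (p z - q z) * s z = |p z - q z| := by
    intro z
    by_cases h : q z ≤ p z
    · simp only [s, h, if_true]; rw [abs_of_nonneg (by linarith)]; ring
    · simp only [s, h, if_false]; rw [abs_of_neg (by linarith)]; ring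
  have hs1 : ∀ z, |V * s z| ≤ V := by
    intro z
    rw [abs_mul, abs_of_nonneg hV0]
    by_cases h : q z ≤ p z <;> simp [s, h]
  have hh := hoeff_aux q (fun z => V * s z) V hV0 (fun z => (hq0 z).le) hq1 hs1
  set B := ∑ z, q z * (V * s z) + V ^ 2 / 2 with hB
  have key : ∀ z, p z * (Real.log (q z / p z) + V * s z - B)
      ≤ q z * Real.exp (V * s z) * Real.exp (-B) - p z := by
    intro z
    have h1 : Real.log (q z / p z) + V * s z - B
        ≤ q z / p z * Real.exp (V * s z) * Real.exp (-B) - 1 := by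
      have := Real.add_one_le_exp (Real.log (q z / p z) + V * s z - B)
      rw [sub_eq_add_neg _ B, Real.exp_add, Real.exp_add,
        Real.exp_log (div_pos (hq0 z) (hp0 z))] at this
      linarith
    have h2 := mul_le_mul_of_nonneg_left h1 (hp0 z).le
    refine h2.trans (le_of_eq ?_)
    have := (hp0 z).ne'
    field_simp
  have hsum := Finset.sum_le_sum fun z (_ : z ∈ Finset.univ) => key z
  rw [Finset.sum_sub_distrib, ← Finset.sum_mul, hp1] at hsum
  have h3 : (∑ z, q z * Real.exp (V * s z)) * Real.exp (-B) ≤ 1 := by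
    calc _ ≤ Real.exp B * Real.exp (-B) :=
          mul_le_mul_of_nonneg_right hh (Real.exp_pos _).le
      _ = 1 := by rw [← Real.exp_add]; simp
  have e1 : ∑ z, p z * (Real.log (q z / p z) + V * s z - B)
      = ∑ z, p z * Real.log (q z / p z) + ∑ z, p z * (V * s z) - B := by
    simp only [mul_sub, mul_add, Finset.sum_sub_distrib, Finset.sum_add_distrib,
      ← Finset.sum_mul, hp1, one_mul]
  have e2 : ∑ z, p z * (V * s z) - ∑ z, q z * (V * s z) = V * V := by
    rw [← Finset.sum_sub_distrib]
    conv_rhs => rw [hV, Finset.mul_sum]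
    apply Finset.sum_congr rfl
    intro z _
    rw [← hV, ← hs z]; ring
  rw [e1] at hsum
  nlinarith

theorem chern_aux {Z : Type*} [Fintype Z] (p q : Z → ℝ)
    (hp0 : ∀ z, 0 < p z) (hp1 : ∑ z, p z = 1)
    (hq0 : ∀ z, 0 < q z) (hq1 : ∑ z, q z = 1) (L ε : ℝ) (hL : 0 < L) (hε : 0 < ε)
    (hpq : ∀ z, |Real.log (q z / p z)| ≤ L)
    (hV : 2 / ε ≤ (∑ z, |p z - q z|) ^ 2) (T : ℕ) :
    ∃ t : ℝ, 0 ≤ t ∧ Real.exp (t * (T / (2 * ε))) *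
      ∑ z : Fin T → Z, ∏ i, (p (z i) * Real.exp (t * Real.log (q (z i) / p (z i))))
      ≤ Real.exp (-(T / (8 * ε ^ 2 * L ^ 2))) := by
  classical
  refine ⟨1 / (2 * ε * L ^ 2), by positivity, ?_⟩
  set t := 1 / (2 * ε * L ^ 2) with ht
  have ht0 : 0 ≤ t := by positivity
  have h1 := hoeff_aux p (fun z => t * Real.log (q z / p z)) (t * L) (by positivity)
    (fun z => (hp0 z).le) hp1 (fun z => by
      rw [abs_mul, abs_of_nonneg ht0]
      exact mul_le_mul_of_nonneg_left (hpq z) ht0)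
  have h2 := pinsker_aux p q hp0 hp1 hq0 hq1
  have e : ∑ z, p z * (t * Real.log (q z / p z)) = t * ∑ z, p z * Real.log (q z / p z) := by
    rw [Finset.mul_sum]; exact Finset.sum_congr rfl fun z _ => by ring
  have h3 : ∑ z, p z * Real.log (q z / p z) ≤ - (1 / ε) := by
    have : 2 / ε = 2 * (1 / ε) := by ring
    linarith
  have h4 : ∑ z, p z * Real.exp (t * Real.log (q z / p z))
      ≤ Real.exp (t * (-(1 / ε)) + (t * L) ^ 2 / 2) := by
    refine h1.trans (Real.exp_le_exp.2 ?_)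
    rw [e]
    have := mul_le_mul_of_nonneg_left h3 ht0
    linarith
  have e5 : ∑ z : Fin T → Z, ∏ i, (p (z i) * Real.exp (t * Real.log (q (z i) / p (z i))))
      = (∑ z, p z * Real.exp (t * Real.log (q z / p z))) ^ T := by
    rw [Fintype.sum_pow]
  rw [e5]
  have h6 := pow_le_pow_left₀ (Finset.sum_nonneg fun z _ =>
    mul_nonneg (hp0 z).le (Real.exp_pos _).le) h4 T
  refine (mul_le_mul_of_nonneg_left h6 (Real.exp_pos _).le).trans (le_of_eq ?_)
  rw [← Real.exp_nat_mul, ← Real.exp_add]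
  congr 1
  rw [ht]
  field_simp
  ring


open Classical in
/-- Classical core of the paper's main learning theorem: mixing each
distribution half-and-half with the uniform distribution, an approximate
empirical maximum-likelihood hypothesis for the mixed distributions is close
in total variation to the true unmixed distribution. -/
theorem stmt11
    (X Z : Type*) [Fintype X] [Nonempty X] [Fintype Z] [Nonempty Z]
    (D : X → Z → ℝ) (hD0 : ∀ s z, 0 ≤ D s z) (hD1 : ∀ s, ∑ z, D s z = 1)
    (P : X → Z → ℝ)
    (hP : ∀ s z, P s z = D s z / 2 + 1 / (2 * (Fintype.card Z : ℝ)))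
    (x : X) (ε δ : ℝ) (hε : 0 < ε) (hδ : 1 ≤ δ)
    (hcard : 2 ≤ (Fintype.card X : ℝ) * δ)
    (T : ℕ) (hT : 0 < T)
    (hTbound : 16 * ε ^ 2 * (Real.log (2 * (Fintype.card Z : ℝ))) ^ 2 *
        (Real.log (Fintype.card X) + Real.log δ) ≤ T) :
    1 - 1 / δ ≤ ∑ z : Fin T → Z,
      (if (∀ h : X,
            Real.exp (-(T : ℝ) / (2 * ε)) *
              (Finset.univ.sup' Finset.univ_nonempty (fun s : X => ∏ i, P s (z i)))
              ≤ ∏ i, P h (z i) →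
            (1 / 2) * ∑ w, |D x w - D h w| ≤ Real.sqrt (2 / ε))
       then ∏ i, P x (z i) else 0) := by

  have hn : (0:ℝ) < Fintype.card Z := by exact_mod_cast Fintype.card_pos
  have hn1 : (1:ℝ) ≤ Fintype.card Z := by exact_mod_cast Fintype.card_pos
  have hN : (0:ℝ) < Fintype.card X := by exact_mod_cast Fintype.card_pos
  have hδ0 : 0 < δ := by linarith
  set L := Real.log (2 * (Fintype.card Z : ℝ)) with hLdef
  have hL : 0 < L := Real.log_pos (by linarith)
  have hPlow : ∀ s z, 1 / (2 * (Fintype.card Z : ℝ)) ≤ P s z := by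
    intro s z
    rw [hP]; have := hD0 s z; linarith
  have hPpos : ∀ s z, 0 < P s z := fun s z => lt_of_lt_of_le (by positivity) (hPlow s z)
  have hPsum : ∀ s, ∑ z, P s z = 1 := by
    intro s
    simp only [hP, Finset.sum_add_distrib, ← Finset.sum_div, hD1]
    rw [Finset.sum_const, Finset.card_univ, nsmul_eq_mul]
    field_simp
    norm_num
  have hPle : ∀ s z, P s z ≤ 1 := by
    intro s z
    rw [← hPsum s]
    exact Finset.single_le_sum (fun i _ => (hPpos s i).le) (Finset.mem_univ z)
  have hlog : ∀ s z, -L ≤ Real.log (P s z) ∧ Real.log (P s z) ≤ 0 := by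
    intro s z
    refine ⟨?_, Real.log_nonpos (hPpos s z).le (hPle s z)⟩
    have := Real.log_le_log (by positivity) (hPlow s z)
    rwa [one_div, Real.log_inv] at this
  have hlogd : ∀ h z, |Real.log (P h z / P x z)| ≤ L := by
    intro h z
    rw [Real.log_div (hPpos h z).ne' (hPpos x z).ne', abs_le]
    have h1 := hlog h z
    have h2 := hlog x z
    constructor <;> linarith [h1.1, h1.2, h2.1, h2.2]
  let bad : X → Prop := fun h => ¬ ((1 / 2) * ∑ w, |D x w - D h w| ≤ Real.sqrt (2 / ε))
  have hbadV : ∀ h, bad h → 2 / ε ≤ (∑ z, |P x z - P h z|) ^ 2 := by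
    intro h hb
    have e : ∑ z, |P x z - P h z| = (1 / 2) * ∑ w, |D x w - D h w| := by
      rw [Finset.mul_sum]
      refine Finset.sum_congr rfl fun z _ => ?_
      rw [hP, hP, show D x z / 2 + 1 / (2 * (Fintype.card Z : ℝ)) -
        (D h z / 2 + 1 / (2 * (Fintype.card Z : ℝ))) = (1 / 2) * (D x z - D h z) by ring,
        abs_mul, abs_of_pos (by norm_num : (0:ℝ) < 1 / 2)]
    rw [e]
    exact Real.sqrt_le_left (by positivity) |>.1 (not_le.1 hb).le
  have hW : ∀ h, ∃ W : (Fin T → Z) → ℝ, (∀ z, 0 ≤ W z) ∧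
      (bad h → ∀ z, Real.exp (-(T : ℝ) / (2 * ε)) * ∏ i, P x (z i) ≤ ∏ i, P h (z i) →
        ∏ i, P x (z i) ≤ W z) ∧ ∑ z, W z ≤ 1 / (Fintype.card X * δ) := by
    intro h
    by_cases hb : bad h
    · obtain ⟨t, ht0, ht⟩ := chern_aux (P x) (P h) (hPpos x) (hPsum x) (hPpos h) (hPsum h)
        L ε hL hε (hlogd h) (hbadV h hb) T
      refine ⟨fun z => Real.exp (t * (T / (2 * ε))) *
        ∏ i, (P x (z i) * Real.exp (t * Real.log (P h (z i) / P x (z i)))), ?_, ?_, ?_⟩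
      · intro z
        exact mul_nonneg (Real.exp_pos _).le (Finset.prod_nonneg fun i _ =>
          mul_nonneg (hPpos _ _).le (Real.exp_pos _).le)
      · intro _ z hz
        have hpx : 0 < ∏ i, P x (z i) := Finset.prod_pos fun i _ => hPpos _ _
        have hph : 0 < ∏ i, P h (z i) := Finset.prod_pos fun i _ => hPpos _ _
        have h1 := Real.log_le_log (by positivity) hz
        rw [Real.log_mul (Real.exp_pos _).ne' hpx.ne', Real.log_exp,
          Real.log_prod (fun i _ => (hPpos _ _).ne'),
          Real.log_prod (fun i _ => (hPpos _ _).ne')] at h1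
        have h2 : 0 ≤ (T:ℝ) / (2 * ε) + ∑ i, Real.log (P h (z i) / P x (z i)) := by
          simp only [Real.log_div (hPpos _ _).ne' (hPpos _ _).ne', Finset.sum_sub_distrib]
          rw [neg_div] at h1
          linarith
        show _ ≤ Real.exp (t * (T / (2 * ε))) *
          ∏ i, (P x (z i) * Real.exp (t * Real.log (P h (z i) / P x (z i))))
        rw [Finset.prod_mul_distrib, ← Real.exp_sum, ← Finset.mul_sum, mul_left_comm,
          ← Real.exp_add, ← mul_add]
        exact le_mul_of_one_le_right hpx.le (Real.one_le_exp (mul_nonneg ht0 h2))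
      · rw [← Finset.mul_sum]
        refine ht.trans ?_
        rw [← Real.log_mul hN.ne' hδ0.ne'] at hTbound
        have hl : 0 ≤ Real.log (Fintype.card X * δ) := Real.log_nonneg (by linarith)
        have h3 : Real.log (Fintype.card X * δ) ≤ T / (8 * ε ^ 2 * L ^ 2) := by
          rw [le_div_iff₀ (by positivity)]
          have : 0 ≤ ε ^ 2 * L ^ 2 * Real.log (Fintype.card X * δ) := by positivity
          nlinarith
        calc _ ≤ Real.exp (-Real.log (Fintype.card X * δ)) := Real.exp_le_exp.2 (by linarith)
          _ = _ := by rw [Real.exp_neg, Real.exp_log (by positivity), one_div]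
    · refine ⟨fun _ => 0, fun _ => le_rfl, fun h' => absurd h' hb, ?_⟩
      simp only [Finset.sum_const_zero]
      positivity
  choose W hW0 hW1 hW2 using hW
  have htot : ∑ z : Fin T → Z, ∏ i, P x (z i) = 1 := by
    rw [← Fintype.sum_pow, hPsum, one_pow]
  have hWtot : ∑ z, ∑ h, W h z ≤ 1 / δ := by
    rw [Finset.sum_comm]
    refine (Finset.sum_le_sum fun h _ => hW2 h).trans (le_of_eq ?_)
    rw [Finset.sum_const, Finset.card_univ, nsmul_eq_mul]
    field_simp
  calc 1 - 1 / δ ≤ ∑ z : Fin T → Z, (∏ i, P x (z i) - ∑ h, W h z) := by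
        rw [Finset.sum_sub_distrib, htot]; linarith
    _ ≤ _ := by
      refine Finset.sum_le_sum fun z _ => ?_
      have hs : 0 ≤ ∑ h, W h z := Finset.sum_nonneg fun h _ => hW0 h z
      split_ifs with hg
      · linarith
      · push Not at hg
        obtain ⟨h, hh1, hh2⟩ := hg
        have h5 := hW1 h (not_le.2 hh2) z ((mul_le_mul_of_nonneg_left
          (Finset.le_sup' (fun s : X => ∏ i, P s (z i)) (Finset.mem_univ x))
          (Real.exp_pos _).le).trans hh1)
        have h6 := Finset.single_le_sum (f := fun h => W h z) (fun h _ => hW0 h z)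
          (Finset.mem_univ h)
        linarith
end
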